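/- arXiv:2601.19086 — 6 statements merged into one kernel-verified Lean document; each statement's English description precedes it below -/
import Mathlib

section
/- Consider N ≥ 2 rigid bodies with attitudes R_i : ℝ → SO(3) and angular velocities ω_i : ℝ → ℝ³ (i = 1,…,N) that are differentiable and satisfy Ṙ_i = R_i ω_i^× and J_i ω̇_i = −ω_i^× J_i ω_i + τ_i, where each J_i ∈ ℝ^{3×3} is symmetric positive definite. Let 𝒢 be an undirected tree on {1,…,N} with neighbor sets 𝒩(i); orient its edges and label them 1,…,N−1, edge k joining j_k (source) and i_k (target), and set R̄_k := R_{j_k}ᵀ R_{i_k}. Let R₀ ∈ SO(3) be constant, let A₀ := A_{1,0} ∈ ℝ^{3×3} be symmetric, A_{i,0} = 0₃ₓ₃ for i ≠ 1, and for each edge k joining {i,j} let A_{i,j} = A_{j,i} = A_k be symmetric. Let k_{R̄₀}, k_{R̄}, k_ω > 0 and take the control torques τ_i = −k_{R̄₀} ψ(A_{i,0} R₀ᵀ R_i) − k_{R̄} ∑_{j ∈ 𝒩(i)} ψ(A_{i,j} R_jᵀ R_i) − k_ω ω_i. Define V(t) := (1/2) [ k_{R̄₀} tr(A₀ (I₃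 − R₀ᵀ R_1(t))) + k_{R̄} ∑_{k=1}^{N−1} tr(A_k (I₃ − R̄_k(t))) + ∑_{i=1}^{N} ω_i(t)ᵀ J_i ω_i(t) ]. Then for all t, V̇(t) = −k_ω ∑_{i=1}^{N} ‖ω_i(t)‖². -/
open Matrix BigOperators

noncomputable section

/-- 3×3 real matrices. -/
abbrev M3 := Matrix (Fin 3) (Fin 3) ℝ

/-- The skew-symmetric matrix `x^×` associated with `x ∈ ℝ³`. -/
def skew (x : Fin 3 → ℝ) : M3 :=
  !![0, -x 2, x 1; x 2, 0, -x 0; -x 1, x 0, 0]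

/-- `vex`, the inverse of `skew` on skew-symmetric matrices. -/
def vex (M : M3) : Fin 3 → ℝ := ![M 2 1, M 0 2, M 1 0]

/-- Antisymmetric projection `P_a(M) = (M - Mᵀ)/2`. -/
def Pa (M : M3) : M3 := (2 : ℝ)⁻¹ • (M - Mᵀ)

/-- `ψ(M) = vex(P_a(M))`. -/
def psi (M : M3) : Fin 3 → ℝ := vex (Pa M)

/-- `E(M) = (tr(M) I₃ - Mᵀ)/2`. -/
def Emat (M : M3) : M3 := (2 : ℝ)⁻¹ • (M.trace • (1 : M3) - Mᵀ)

/-- The rotation by angle `θ` about axis `u`. -/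
def rotAA (θ : ℝ) (u : Fin 3 → ℝ) : M3 :=
  1 + Real.sin θ • skew u + (1 - Real.cos θ) • (skew u * skew u)

/-- Membership in SO(3). -/
def SO3 (R : M3) : Prop := Rᵀ * R = 1 ∧ R * Rᵀ = 1 ∧ R.det = 1

/-- The `(i,k)` 3×3 block of the matrix `L`: `I₃` if `i` is the target of
edge `k`, `-R̄_k` if `i` is its source, `0` otherwise. -/
def Lblk {n N : ℕ} (src tgt : Fin n → Fin N) (Rb : Fin n → M3)
    (i : Fin N) (k : Fin n) : M3 :=
  if i = tgt k then 1 else if i = src k then -(Rb k) else 0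

/-- The full `3N × 3(N-1)` matrix `L`, indexed by (vertex, coordinate) pairs. -/
def Lmat {n N : ℕ} (src tgt : Fin n → Fin N) (Rb : Fin n → M3) :
    Matrix (Fin N × Fin 3) (Fin n × Fin 3) ℝ :=
  fun p q => Lblk src tgt Rb p.1 q.1 p.2 q.2

/-- Each edge of a graph, labelled once by `src`, `tgt`, is counted twice in the sum over
all ordered pairs of neighbours. -/
lemma sum_neighborFinset_eq_sum_edges {V E : Type*} [Fintype V] [DecidableEq V] [Fintype E]
    [DecidableEq E] (G : SimpleGraph V) [DecidableRel G.Adj] (src tgt : E → V)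
    (hadj : ∀ k, G.Adj (src k) (tgt k))
    (hinj : Function.Injective fun k => s(src k, tgt k))
    (κ : V → V → E) (hκ : ∀ i j, G.Adj i j → s(src (κ i j), tgt (κ i j)) = s(i, j))
    (g : V → V → ℝ) :
    ∑ i, ∑ j ∈ G.neighborFinset i, g i j
      = ∑ k, (g (src k) (tgt k) + g (tgt k) (src k)) := by
  rw [Finset.sum_sigma', ← Finset.sum_fiberwise (g := fun p : (_ : V) × V => κ p.1 p.2)]
  refine Finset.sum_congr rfl fun k _ => ?_
  have hne : (⟨src k, tgt k⟩ : (_ : V) × V) ≠ ⟨tgt k, src k⟩ := fun h =>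
    (hadj k).ne (congrArg Sigma.fst h)
  rw [← Finset.sum_pair (f := fun p : (_ : V) × V => g p.1 p.2) hne]
  refine Finset.sum_congr ?_ fun _ _ => rfl
  ext ⟨i, j⟩
  simp only [Finset.mem_filter, Finset.mem_sigma, Finset.mem_univ, true_and,
    SimpleGraph.mem_neighborFinset, Finset.mem_insert, Finset.mem_singleton, Sigma.mk.injEq,
    heq_eq_eq]
  constructor
  · rintro ⟨h, rfl⟩
    have := hκ i j h
    rw [Sym2.eq_iff] at this
    tauto
  · rintro (⟨rfl, rfl⟩ | ⟨rfl, rfl⟩)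
    · exact ⟨hadj k, hinj (hκ _ _ (hadj k))⟩
    · exact ⟨(hadj k).symm, hinj ((hκ _ _ (hadj k).symm).trans Sym2.eq_swap)⟩

/-- `tr(M x^×) = -2 xᵀ ψ(M)`. -/
lemma trace_mul_skew (M : M3) (x : Fin 3 → ℝ) :
    (M * skew x).trace = -2 * (x ⬝ᵥ psi M) := by
  simp [Matrix.trace, Matrix.mul_apply, Fin.sum_univ_three, skew, psi, vex, Pa, dotProduct]
  ring

lemma psi_transpose (M : M3) : psi Mᵀ = -psi M := by
  ext i
  fin_cases i <;> simp [psi, vex, Pa] <;> ring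

lemma transpose_skew (x : Fin 3 → ℝ) : (skew x)ᵀ = -skew x := by
  ext i j
  fin_cases i <;> fin_cases j <;> simp [skew]

lemma dotProduct_skew_mulVec_self (x y : Fin 3 → ℝ) : x ⬝ᵥ (skew x *ᵥ y) = 0 := by
  simp [skew, dotProduct, Matrix.mulVec, Fin.sum_univ_three]
  ring

/-- The derivative of `tr(A (I - PᵀQ))` for differentiable matrix curves `P`, `Q`. -/
lemma hasDerivAt_trace_mul_one_sub (A : M3) {P Q : ℝ → M3} {P' Q' : M3} {t : ℝ}
    (hP : ∀ a b, HasDerivAt (fun s => P s a b) (P' a b) t)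
    (hQ : ∀ a b, HasDerivAt (fun s => Q s a b) (Q' a b) t) :
    HasDerivAt (fun s => (A * (1 - (P s)ᵀ * Q s)).trace)
      (-(A * (P'ᵀ * Q t + (P t)ᵀ * Q')).trace) t := by
  have h : ∀ b a, HasDerivAt (fun s => ((P s)ᵀ * Q s) b a)
      ((P'ᵀ * Q t + (P t)ᵀ * Q') b a) t := by
    intro b a
    simp only [Matrix.mul_apply, Matrix.add_apply, Matrix.transpose_apply,
      ← Finset.sum_add_distrib]
    exact HasDerivAt.fun_sum fun c _ => (hP c b).mul (hQ c a)
  rw [← Matrix.trace_neg, ← Matrix.mul_neg]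
  simp only [Matrix.trace, Matrix.diag, Matrix.mul_apply (M := A)]
  exact HasDerivAt.fun_sum fun a _ => HasDerivAt.fun_sum fun b _ =>
    ((h b a).const_sub ((1 : M3) b a)).const_mul (A a b)

/-- The derivative of `tr(A (I - PᵀQ))` for attitude curves `P`, `Q` with angular
velocities `x`, `y`. -/
lemma hasDerivAt_trace_relative_attitude {A : M3} (hA : Aᵀ = A) {P Q : ℝ → M3}
    {x y : Fin 3 → ℝ} {t : ℝ}
    (hP : ∀ a b, HasDerivAt (fun s => P s a b) ((P t * skew x) a b) t)
    (hQ : ∀ a b, HasDerivAt (fun s => Q s a b) ((Q t * skew y) a b) t) :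
    HasDerivAt (fun s => (A * (1 - (P s)ᵀ * Q s)).trace)
      (2 * (x ⬝ᵥ psi (A * (Q t)ᵀ * P t) + y ⬝ᵥ psi (A * (P t)ᵀ * Q t))) t := by
  convert hasDerivAt_trace_mul_one_sub A hP hQ using 1
  have h1 : (A * ((P t * skew x)ᵀ * Q t)).trace
      = -(((A * (Q t)ᵀ * P t)ᵀ * skew x).trace) := by
    rw [Matrix.transpose_mul (P t), transpose_skew, Matrix.neg_mul, Matrix.neg_mul,
      Matrix.mul_neg, Matrix.trace_neg, Matrix.mul_assoc (skew x), ← Matrix.mul_assoc A,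
      Matrix.trace_mul_comm (A * skew x)]
    simp only [Matrix.transpose_mul, Matrix.transpose_transpose, hA, Matrix.mul_assoc]
  have h2 : (A * ((P t)ᵀ * (Q t * skew y))).trace
      = ((A * (P t)ᵀ * Q t) * skew y).trace := by
    simp only [Matrix.mul_assoc]
  rw [Matrix.mul_add, Matrix.trace_add, h1, h2, trace_mul_skew, trace_mul_skew,
    psi_transpose, dotProduct_neg]
  ring

/-- The derivative of the quadratic form `xᵀ J x` for symmetric `J`. -/
lemma hasDerivAt_dotProduct_mulVec {J : M3} (hJ : Jᵀ = J) {x : ℝ → Fin 3 → ℝ}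
    {x' : Fin 3 → ℝ} {t : ℝ} (hx : ∀ a, HasDerivAt (fun s => x s a) (x' a) t) :
    HasDerivAt (fun s => x s ⬝ᵥ (J *ᵥ x s)) (2 * (x t ⬝ᵥ (J *ᵥ x'))) t := by
  have h : HasDerivAt (fun s => x s ⬝ᵥ (J *ᵥ x s))
      (x' ⬝ᵥ (J *ᵥ x t) + x t ⬝ᵥ (J *ᵥ x')) t := by
    simp only [dotProduct, Matrix.mulVec, ← Finset.sum_add_distrib]
    refine HasDerivAt.fun_sum fun a _ => (hx a).mul ?_
    exact HasDerivAt.fun_sum fun b _ => (hx b).const_mul _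
  have hs : x' ⬝ᵥ (J *ᵥ x t) = x t ⬝ᵥ (J *ᵥ x') := by
    rw [Matrix.dotProduct_mulVec, ← Matrix.mulVec_transpose, hJ, dotProduct_comm]
  rw [hs, ← two_mul] at h
  exact h

/-- For `N = n+1 ≥ 2` rigid bodies `Ṙᵢ = Rᵢ ωᵢ^×`,
`Jᵢ ω̇ᵢ = -ωᵢ^× Jᵢ ωᵢ + τᵢ` (stated entrywise), communicating over an undirected tree,
with the proposed control torques, the Lyapunov function
`V = (1/2)(k_{R̄₀} tr(A₀(I - R₀ᵀR₁)) + k_{R̄} ∑ₖ tr(Aₖ(I - R̄ₖ)) + ∑ᵢ ωᵢᵀ Jᵢ ωᵢ)`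
satisfies `V̇ = -k_ω ∑ᵢ ‖ωᵢ‖²`. -/
theorem stmt7 {n : ℕ} (hn : 1 ≤ n)
    (G : SimpleGraph (Fin (n + 1))) [DecidableRel G.Adj] (hT : G.IsTree)
    (src tgt : Fin n → Fin (n + 1))
    (hadj : ∀ k, G.Adj (src k) (tgt k))
    (hinj : Function.Injective fun k => s(src k, tgt k))
    (hsurj : ∀ e ∈ G.edgeSet, ∃ k, e = s(src k, tgt k))
    (κ : Fin (n + 1) → Fin (n + 1) → Fin n)
    (hκ : ∀ i j, G.Adj i j → s(src (κ i j), tgt (κ i j)) = s(i, j))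
    (R : Fin (n + 1) → ℝ → M3) (ω ωdot : Fin (n + 1) → ℝ → Fin 3 → ℝ)
    (J : Fin (n + 1) → M3) (hJ : ∀ i, (J i).PosDef)
    (R0 : M3) (hR0 : SO3 R0)
    (A0 : M3) (hA0 : A0ᵀ = A0)
    (A : Fin n → M3) (hA : ∀ k, (A k)ᵀ = A k)
    (k0 kR kw : ℝ) (hk0 : 0 < k0) (hkR : 0 < kR) (hkw : 0 < kw)
    (hSO3 : ∀ i t, SO3 (R i t))
    (hRdot : ∀ i t a b, HasDerivAt (fun s => R i s a b) ((R i t * skew (ω i t)) a b) t)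
    (hωdot : ∀ i t a, HasDerivAt (fun s => ω i s a) (ωdot i t a) t)
    (τ : Fin (n + 1) → ℝ → Fin 3 → ℝ)
    (hτ : ∀ i t, τ i t =
      -(k0 • psi ((if i = 0 then A0 else 0) * R0ᵀ * R i t))
      - kR • (∑ j ∈ G.neighborFinset i, psi (A (κ i j) * (R j t)ᵀ * R i t))
      - kw • ω i t)
    (hdyn : ∀ i t, J i *ᵥ ωdot i t = -(skew (ω i t) *ᵥ (J i *ᵥ ω i t)) + τ i t)
    (V : ℝ → ℝ)
    (hV : ∀ t, V t = (1 / 2) * (k0 * (A0 * (1 - R0ᵀ * R 0 t)).trace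
      + kR * ∑ k : Fin n, (A k * (1 - (R (src k) t)ᵀ * R (tgt k) t)).trace
      + ∑ i : Fin (n + 1), ω i t ⬝ᵥ (J i *ᵥ ω i t))) :
    ∀ t, HasDerivAt V (-kw * ∑ i : Fin (n + 1), ω i t ⬝ᵥ ω i t) t := by
  intro t
  have hA0' := hasDerivAt_trace_relative_attitude (P := fun _ => R0) (x := 0) (t := t) hA0
    (fun a b => by
      have h0 : skew 0 = 0 := by ext i j; fin_cases i <;> fin_cases j <;> simp [skew]
      simpa [h0] using hasDerivAt_const t (R0 a b)) (hRdot 0 t)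
  have hE := HasDerivAt.fun_sum (u := Finset.univ) fun k _ =>
    hasDerivAt_trace_relative_attitude (hA k) (hRdot (src k) t) (hRdot (tgt k) t)
  have hK := HasDerivAt.fun_sum (u := Finset.univ) fun i _ =>
    hasDerivAt_dotProduct_mulVec (J := J i)
      (by simpa [Matrix.conjTranspose_eq_transpose_of_trivial] using (hJ i).isHermitian.eq)
      (hωdot i t)
  rw [funext hV]
  refine ((((hA0'.const_mul k0).add (hE.const_mul kR)).add hK).const_mul (1 / 2)).congr_deriv ?_
  have hκ1 : ∀ k, κ (src k) (tgt k) = k := fun k => hinj (hκ _ _ (hadj k))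
  have hκ2 : ∀ k, κ (tgt k) (src k) = k := fun k =>
    hinj ((hκ _ _ (hadj k).symm).trans Sym2.eq_swap)
  have hsum := sum_neighborFinset_eq_sum_edges G src tgt hadj hinj κ hκ
    fun i j => ω i t ⬝ᵥ psi (A (κ i j) * (R j t)ᵀ * R i t)
  simp only [hκ1, hκ2] at hsum
  have hpsi0 : psi 0 = 0 := by ext i; fin_cases i <;> simp [psi, vex, Pa]
  have hroot : ∑ i, ω i t ⬝ᵥ psi ((if i = 0 then A0 else 0) * R0ᵀ * R i t)
      = ω 0 t ⬝ᵥ psi (A0 * R0ᵀ * R 0 t) := by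
    rw [Finset.sum_eq_single 0]
    · simp
    · intro i _ hi
      simp [hi, hpsi0]
    · simp
  have hdot : ∀ i, ω i t ⬝ᵥ (J i *ᵥ ωdot i t)
      = -(k0 * (ω i t ⬝ᵥ psi ((if i = 0 then A0 else 0) * R0ᵀ * R i t)))
        - kR * ∑ j ∈ G.neighborFinset i, ω i t ⬝ᵥ psi (A (κ i j) * (R j t)ᵀ * R i t)
        - kw * (ω i t ⬝ᵥ ω i t) := by
    intro i
    rw [hdyn, hτ, dotProduct_add, dotProduct_neg, dotProduct_skew_mulVec_self, dotProduct_sub,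
      dotProduct_sub, dotProduct_neg, dotProduct_smul, dotProduct_smul, dotProduct_smul,
      dotProduct_sum]
    simp only [smul_eq_mul]
    ring
  simp only [hdot, ← Finset.mul_sum, Finset.sum_sub_distrib, Finset.sum_neg_distrib, hroot, hsum,
    zero_dotProduct]
  ring
end
end

section
/- Let N ≥ 2, let 𝒢 be an undirected tree on {1,…,N} with edges oriented and labeled 1,…,N−1 (edge k joining j_k source and i_k target), let R̄_1,…,R̄_{N−1} ∈ SO(3), and let L ∈ ℝ^{3N×3(N−1)} be the block matrix whose (i,k) 3×3 block is I₃ if i = i_k, −R̄_k if i = j_k, and 0₃ₓ₃ otherwise. Let R̄₀ ∈ SO(3), let A₀, A_1, …, A_{N−1} ∈ ℝ^{3×3}, and let k_{R̄₀}, k_{R̄} > 0. Set Ψ₀ := (ψ(A₀ R̄₀)ᵀ, 0, …, 0)ᵀ ∈ ℝ^{3N} and Ψ̄ := (ψ(A_1 R̄_1)ᵀ, …, ψ(A_{N−1} R̄_{N−1})ᵀ)ᵀ ∈ ℝ^{3(N−1)}. If k_{R̄₀} Ψ₀ + k_{R̄} L Ψ̄ = 0, then ψ(A_k R̄_k) =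 0 for all k = 1,…,N−1 and ψ(A₀ R̄₀) = 0. -/
open Matrix BigOperators

noncomputable section

/-- In a tree, a vertex has at most one neighbor that is closer to a given root. -/
lemma SimpleGraph.IsTree.eq_of_adj_of_dist_lt {V : Type*} {G : SimpleGraph V} (hT : G.IsTree)
    {r v w w' : V} (hw : G.Adj w v) (hw' : G.Adj w' v)
    (hlt : G.dist r w < G.dist r v) (hlt' : G.dist r w' < G.dist r v) : w = w' := by
  have exists_path : ∀ u, G.Adj u v → G.dist r u < G.dist r v →
      ∃ p : G.Walk r v, p.IsPath ∧ p.penultimate = u := by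
    intro u hu hlt
    obtain ⟨p, hp⟩ := hT.connected.exists_walk_length_eq_dist r u
    refine ⟨p.concat hu, (p.concat hu).isPath_of_length_eq_dist ?_, by simp⟩
    have hle := SimpleGraph.dist_le (p.concat hu)
    rw [SimpleGraph.Walk.length_concat] at hle ⊢
    omega
  obtain ⟨p, hp, rfl⟩ := exists_path w hw hlt
  obtain ⟨q, hq, rfl⟩ := exists_path w' hw' hlt'
  rw [(hT.existsUnique_path r v).unique hp hq]

/-- A family on the labeled edges of a tree vanishes if no vertex other than the root is
incident to exactly one edge on which the family is nonzero. -/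
lemma SimpleGraph.IsTree.edge_family_eq_zero {V ι M : Type*} [Finite ι] [Zero M]
    {G : SimpleGraph V} (hT : G.IsTree) (r : V) (src tgt : ι → V)
    (hadj : ∀ k, G.Adj (src k) (tgt k)) (hinj : Function.Injective fun k => s(src k, tgt k))
    (x : ι → M)
    (hx : ∀ v ≠ r, ∀ k, v ∈ s(src k, tgt k) →
      (∀ l ≠ k, v ∈ s(src l, tgt l) → x l = 0) → x k = 0) (k : ι) : x k = 0 := by
  have : Fintype ι := Fintype.ofFinite ι
  classical
  by_contra hk
  obtain ⟨m, hm, hmax⟩ := Finset.exists_max_image (Finset.univ.filter fun k => x k ≠ 0)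
    (fun k => max (G.dist r (src k)) (G.dist r (tgt k))) ⟨k, by simpa using hk⟩
  simp only [Finset.mem_filter, Finset.mem_univ, true_and] at hm hmax
  obtain ⟨v, w, hvw, hlt⟩ : ∃ v w, s(src m, tgt m) = s(w, v) ∧ G.dist r w < G.dist r v := by
    rcases (hT.dist_ne_of_adj r (hadj m)).lt_or_gt with h | h
    · exact ⟨_, _, rfl, h⟩
    · exact ⟨_, _, Sym2.eq_swap, h⟩
  have hwv : G.Adj w v := by
    rw [← SimpleGraph.mem_edgeSet, ← hvw]
    exact hadj m
  have hdist : max (G.dist r (src m)) (G.dist r (tgt m)) = G.dist r v := by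
    rcases Sym2.eq_iff.1 hvw with ⟨h₁, h₂⟩ | ⟨h₁, h₂⟩ <;> rw [h₁, h₂]
    · exact max_eq_right hlt.le
    · exact max_eq_left hlt.le
  refine hm (hx v ?_ m (by simp [hvw]) fun l hlm hvl => ?_)
  · rintro rfl
    simp at hlt
  by_contra hl
  obtain ⟨u, hu⟩ := Sym2.mem_iff_exists.1 hvl
  have huv : G.Adj u v := by
    rw [← SimpleGraph.mem_edgeSet, Sym2.eq_swap, ← hu]
    exact hadj l
  have hle : G.dist r u ≤ G.dist r v := by
    have h := hmax l hl
    rw [hdist, max_le_iff] at h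
    rcases Sym2.eq_iff.1 hu with ⟨-, h₂⟩ | ⟨h₁, -⟩
    · exact h₂ ▸ h.2
    · exact h₁ ▸ h.1
  have huw := hT.eq_of_adj_of_dist_lt huv hwv
    (lt_of_le_of_ne hle (hT.dist_ne_of_adj r huv)) hlt
  exact hlm (hinj (by simp only [hu, hvw, huw, Sym2.eq_swap]))

lemma Lmat_mulVec_apply {n N : ℕ} (src tgt : Fin n → Fin N) (Rb : Fin n → M3)
    (x : Fin n → Fin 3 → ℝ) (v : Fin N) (i : Fin 3) :
    (Lmat src tgt Rb *ᵥ fun q : Fin n × Fin 3 => x q.1 q.2) (v, i)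
      = ∑ k, (Lblk src tgt Rb v k *ᵥ x k) i := by
  simp only [Matrix.mulVec, dotProduct, Lmat, Fintype.sum_prod_type]

lemma Lblk_eq_zero {n N : ℕ} {src tgt : Fin n → Fin N} {Rb : Fin n → M3} {v : Fin N} {k : Fin n}
    (hv : v ∉ s(src k, tgt k)) : Lblk src tgt Rb v k = 0 := by
  simp only [Sym2.mem_iff, not_or] at hv
  simp [Lblk, hv.1, hv.2]

/-- The blocks of `L` at the endpoints of an edge are injective. -/
lemma eq_zero_of_Lblk_mulVec_eq_zero {n N : ℕ} {src tgt : Fin n → Fin N} {Rb : Fin n → M3}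
    {v : Fin N} {k : Fin n} (hR : SO3 (Rb k)) (hv : v ∈ s(src k, tgt k)) {x : Fin 3 → ℝ}
    (hx : Lblk src tgt Rb v k *ᵥ x = 0) : x = 0 := by
  unfold Lblk at hx
  split_ifs at hx with h₁ h₂
  · simpa using hx
  · rw [Matrix.neg_mulVec, neg_eq_zero] at hx
    rw [← Matrix.one_mulVec x, ← hR.1, ← Matrix.mulVec_mulVec, hx, Matrix.mulVec_zero]
  · simp [h₁, h₂] at hv

/-- With `L` built from the tree and `R̄_k ∈ SO(3)`, if
`k_{R̄₀} Ψ₀ + k_{R̄} L Ψ̄ = 0`, where `Ψ₀ = (ψ(A₀R̄₀)ᵀ, 0, …, 0)ᵀ` and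
`Ψ̄ = (ψ(A₁R̄₁)ᵀ, …, ψ(A_{N-1}R̄_{N-1})ᵀ)ᵀ`, then all `ψ(A_k R̄_k) = 0`
and `ψ(A₀ R̄₀) = 0`. -/
theorem stmt8 {n : ℕ} (hn : 1 ≤ n)
    (G : SimpleGraph (Fin (n + 1))) (hT : G.IsTree)
    (src tgt : Fin n → Fin (n + 1))
    (hadj : ∀ k, G.Adj (src k) (tgt k))
    (hinj : Function.Injective fun k => s(src k, tgt k))
    (hsurj : ∀ e ∈ G.edgeSet, ∃ k, e = s(src k, tgt k))
    (Rb : Fin n → M3) (hRb : ∀ k, SO3 (Rb k))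
    (Rb0 : M3) (hRb0 : SO3 Rb0)
    (A0 : M3) (A : Fin n → M3)
    (k0 kR : ℝ) (hk0 : 0 < k0) (hkR : 0 < kR)
    (h : (k0 • fun p : Fin (n + 1) × Fin 3 => if p.1 = 0 then psi (A0 * Rb0) p.2 else 0)
        + kR • (Lmat src tgt Rb *ᵥ fun q : Fin n × Fin 3 => psi (A q.1 * Rb q.1) q.2)
        = 0) :
    (∀ k, psi (A k * Rb k) = 0) ∧ psi (A0 * Rb0) = 0 := by
  have row : ∀ v i, k0 * (if v = 0 then psi (A0 * Rb0) i else 0)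
      + kR * ∑ k, (Lblk src tgt Rb v k *ᵥ psi (A k * Rb k)) i = 0 := by
    intro v i
    rw [← Lmat_mulVec_apply src tgt Rb (fun k => psi (A k * Rb k))]
    exact congrFun h (v, i)
  have hzero : ∀ k, psi (A k * Rb k) = 0 := by
    refine hT.edge_family_eq_zero 0 src tgt hadj hinj (fun k => psi (A k * Rb k)) ?_
    intro v hv k hvk hother
    refine eq_zero_of_Lblk_mulVec_eq_zero (hRb k) hvk (funext fun i => ?_)
    have hrow := row v i
    rw [Finset.sum_eq_single k ?_ (by simp)] at hrow
    · simpa [hv, hkR.ne'] using hrow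
    · intro l _ hlk
      by_cases hvl : v ∈ s(src l, tgt l)
      · simp [hother l hlk hvl]
      · simp [Lblk_eq_zero hvl]
  refine ⟨hzero, funext fun i => ?_⟩
  simpa [hzero, hk0.ne'] using row 0 i
end
end

section
/- Let N ≥ 2, let 𝒢 be an undirected tree on {1,…,N} with edges oriented and labeled 1,…,N−1 (edge k joining j_k source and i_k target), let R̄_1,…,R̄_{N−1}, R̄₀ ∈ SO(3), and let L ∈ ℝ^{3N×3(N−1)} be the block matrix whose (i,k) 3×3 block is I₃ if i = i_k, −R̄_k if i = j_k, and 0₃ₓ₃ otherwise. Let A₀, A_1, …, A_{N−1} ∈ ℝ^{3×3} be symmetric positive definite, each with three distinct eigenvalues, and let k_{R̄₀}, k_{R̄} > 0. Set Ψ₀ := (ψ(A₀ R̄₀)ᵀ, 0, …, 0)ᵀ ∈ ℝ^{3N} and Ψ̄ := (ψ(A_1 R̄_1)ᵀ, …, ψ(A_{N−1} R̄_{N−1})ᵀ)ᵀ. Then k_{R̄₀} Ψ₀ + k_{R̄} L Ψ̄ = 0 holds if and only if R̄₀ ∈ {I₃} ∪ {ℛ(π, v) : v a unit eigenvector of A₀}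 and, for every k = 1,…,N−1, R̄_k ∈ {I₃} ∪ {ℛ(π, v) : v a unit eigenvector of A_k}. -/
open Matrix BigOperators

noncomputable section

theorem psi_eq_zero_iff (M : M3) : psi M = 0 ↔ Mᵀ = M := by
  constructor
  · intro h
    have h0 := congrFun h 0
    have h1 := congrFun h 1
    have h2 := congrFun h 2
    simp [psi, vex, Pa] at h0 h1 h2
    ext i j
    fin_cases i <;> fin_cases j <;> simp <;> linarith
  · intro h
    simp [psi, vex, Pa, h]

theorem rotAA_pi (v : Fin 3 → ℝ) (hv : v ⬝ᵥ v = 1) :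
    rotAA Real.pi v = (2 : ℝ) • vecMulVec v v - 1 := by
  simp only [dotProduct, Fin.sum_univ_three] at hv
  ext i j
  fin_cases i <;> fin_cases j <;>
    simp [rotAA, skew, vecMulVec] <;> linarith

/-- The equation `A K + K A = 0` has only the zero solution when `A` is positive definite. -/
theorem eq_zero_of_anticommute_posDef {m : Type*} [Fintype m] [DecidableEq m]
    {A K : Matrix m m ℝ} (hA : A.PosDef) (h : A * K + K * A = 0) : K = 0 := by
  have h1 : (Kᴴ * A * K).PosSemidef := hA.posSemidef.conjTranspose_mul_mul_same K
  have h2 : (K * A * Kᴴ).PosSemidef := hA.posSemidef.mul_mul_conjTranspose_same K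
  have h3 : (Kᴴ * A * K).trace + (K * A * Kᴴ).trace = 0 := by
    rw [Matrix.trace_mul_comm (K * A) Kᴴ, Matrix.mul_assoc, ← Matrix.trace_add,
      ← Matrix.mul_add, h, Matrix.mul_zero, Matrix.trace_zero]
  have h4 : (Kᴴ * A * K).trace = 0 := by
    linarith [h1.trace_nonneg, h2.trace_nonneg]
  have h5 := h1.trace_eq_zero_iff.1 h4
  refine Matrix.ext_of_mulVec_single fun j => ?_
  by_contra hx
  rw [Matrix.zero_mulVec] at hx
  have h6 := hA.dotProduct_mulVec_pos hx
  have h7 : star (K *ᵥ Pi.single j 1) ⬝ᵥ (A *ᵥ (K *ᵥ Pi.single j 1))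
      = star (Pi.single j (1 : ℝ)) ⬝ᵥ ((Kᴴ * A * K) *ᵥ Pi.single j 1) := by
    simp only [Matrix.star_mulVec, Matrix.vecMul_vecMul, Matrix.dotProduct_mulVec,
      Matrix.mul_assoc]
  rw [h7, h5] at h6
  simp at h6

/-- If `A * R` is symmetric with `R` orthogonal and `A` positive definite, then `R` is a symmetric
involution commuting with `A`. -/
theorem isSymm_and_commute_of_mul_isSymm {m : Type*} [Fintype m] [DecidableEq m]
    {A R : Matrix m m ℝ} (hA : A.PosDef) (hR : R * Rᵀ = 1)
    (h : (A * R)ᵀ = A * R) :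
    Rᵀ = R ∧ A * R = R * A := by
  have hAt : Aᵀ = A := by simpa using hA.isHermitian.eq
  have hS : Rᵀ * A = A * R := by rw [← h, Matrix.transpose_mul, hAt]
  have hsq : (A * R) * (A * R) = A * A := by
    nth_rewrite 2 [← hS]
    rw [Matrix.mul_assoc, ← Matrix.mul_assoc R, hR, Matrix.one_mul]
  have hc : A * (A * R) - (A * R) * A = 0 := by
    apply eq_zero_of_anticommute_posDef hA
    have : A * A * (A * R) = (A * R) * (A * A) := by
      rw [← hsq]; noncomm_ring
    calc _ = A * A * (A * R) - (A * R) * (A * A) := by noncomm_ring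
      _ = 0 := sub_eq_zero.2 this
  have hu : IsUnit A := hA.isUnit
  have hcomm : A * R = R * A := by
    apply hu.mul_left_cancel
    rw [sub_eq_zero] at hc
    rw [hc, Matrix.mul_assoc]
  refine ⟨?_, hcomm⟩
  apply hu.mul_right_cancel
  rw [hS, hcomm]

theorem eq_one_or_eq_of_isSymm {R : M3} (hR : SO3 R) (hs : Rᵀ = R) :
    R = 1 ∨ ∃ v : Fin 3 → ℝ, v ⬝ᵥ v = 1 ∧ R = (2 : ℝ) • vecMulVec v v - 1 := by
  obtain ⟨hR1, hR2, hdet⟩ := hR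
  have hRR : R * R = 1 := by rw [hs] at hR1; exact hR1
  have hadj : R.adjugate = R := by
    calc R.adjugate = R * (R * R.adjugate) := by rw [← Matrix.mul_assoc, hRR, Matrix.one_mul]
      _ = R := by rw [Matrix.mul_adjugate, hdet, one_smul, Matrix.mul_one]
  have s : ∀ i j, R i j = R j i := fun i j => congrFun (congrFun hs j) i
  have s1 := s 1 0
  have s2 := s 2 0
  have s3 := s 2 1
  have hm : ∀ i j, (R * R) i j = (1 : M3) i j := fun i j => by rw [hRR]
  have ha : ∀ i j, R.adjugate i j = R i j := fun i j => by rw [hadj]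
  have m00 := hm 0 0
  have m11 := hm 1 1
  have m22 := hm 2 2
  have m01 := hm 0 1
  have m02 := hm 0 2
  have m12 := hm 1 2
  have a00 := ha 0 0
  have a11 := ha 1 1
  have a22 := ha 2 2
  have a01 := ha 0 1
  have a02 := ha 0 2
  have a12 := ha 1 2
  simp [Matrix.mul_apply, Matrix.adjugate_fin_three, Fin.sum_univ_three, s1, s2, s3]
    at m00 m11 m22 m01 m02 m12 a00 a11 a22 a01 a02 a12
  by_cases ht : 1 + R.trace = 0
  · right
    rw [Matrix.trace_fin_three] at ht
    have hM : ∀ i k l, (1 + R) k i * (1 + R) l i = (1 + R) k l * (1 + R) i i := by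
      intro i k l
      fin_cases i <;> fin_cases k <;> fin_cases l <;> simp [s1, s2, s3] <;> linarith
    have hsq : ∀ i, ∑ k, (1 + R) k i * (1 + R) k i = 2 * (1 + R) i i := by
      intro i
      fin_cases i <;> simp [Fin.sum_univ_three, s1, s2, s3] <;> linarith
    obtain ⟨i, hi⟩ : ∃ i, 0 < (1 + R) i i := by
      by_contra! hneg
      have := hneg 0
      have := hneg 1
      have := hneg 2
      simp at *
      linarith
    have hpos : 0 < 2 * (1 + R) i i := by positivity
    have hss := Real.mul_self_sqrt hpos.le
    set r := Real.sqrt (2 * (1 + R) i i)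
    refine ⟨fun k => (1 + R) k i / r, ?_, ?_⟩
    · simp only [dotProduct, div_mul_div_comm, ← Finset.sum_div, hss]
      rw [hsq, div_self hpos.ne']
    · ext k l
      have h1 : (1 + R) k i / r * ((1 + R) l i / r) = (1 + R) k l / 2 := by
        rw [div_mul_div_comm, hss, hM]
        field_simp
      change R k l = 2 * ((1 + R) k i / r * ((1 + R) l i / r)) - (1 : M3) k l
      rw [h1, Matrix.add_apply]
      ring
  · left
    ext i j
    apply mul_left_cancel₀ ht
    rw [Matrix.trace_fin_three]
    fin_cases i <;> fin_cases j <;> simp [s1, s2, s3, -mul_eq_zero] <;> linarith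

theorem psi_mul_eq_zero_iff {A R : M3} (hA : A.PosDef) (hR : SO3 R) :
    psi (A * R) = 0 ↔ (R = 1 ∨ ∃ v : Fin 3 → ℝ, v ⬝ᵥ v = 1 ∧ (∃ μ : ℝ, A *ᵥ v = μ • v)
      ∧ R = rotAA Real.pi v) := by
  have hAt : Aᵀ = A := by simpa using hA.isHermitian.eq
  rw [psi_eq_zero_iff]
  constructor
  · intro h
    obtain ⟨hs, hc⟩ := isSymm_and_commute_of_mul_isSymm hA hR.2.1 h
    refine (eq_one_or_eq_of_isSymm hR hs).imp_right ?_
    rintro ⟨v, hv, rfl⟩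
    refine ⟨v, hv, ⟨v ⬝ᵥ (A *ᵥ v), ?_⟩, (rotAA_pi v hv).symm⟩
    have h1 := congrArg (· *ᵥ v) hc
    simp only [Matrix.mul_sub, Matrix.sub_mul, Matrix.mul_one, Matrix.one_mul, Matrix.mul_smul,
      Matrix.smul_mul] at h1
    simp only [Matrix.sub_mulVec, Matrix.smul_mulVec, sub_left_inj, ← Matrix.mulVec_mulVec,
      vecMulVec_mulVec, hv, Matrix.mulVec_smul] at h1
    simpa using h1
  · rintro (rfl | ⟨v, hv, ⟨μ, hμ⟩, rfl⟩)
    · simpa using hAt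
    · have h1 : A * vecMulVec v v = μ • vecMulVec v v := by
        rw [Matrix.mul_vecMulVec, hμ, Matrix.smul_vecMulVec]
      rw [rotAA_pi v hv, Matrix.mul_sub, Matrix.mul_smul, h1]
      simp [hAt, Matrix.transpose_vecMulVec]

/-- The map `y ↦ (Lᵀ y, y₀)`, written out vertex by vertex. -/
def transposeMap {n : ℕ} (src tgt : Fin n → Fin (n + 1)) (Rb : Fin n → M3) :
    (Fin (n + 1) × Fin 3 → ℝ) →ₗ[ℝ] (Fin n × Fin 3 → ℝ) × (Fin 3 → ℝ) :=
  ((Lmat src tgt Rb)ᵀ.mulVecLin).prod (LinearMap.funLeft ℝ ℝ fun j => (0, j))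

theorem Lmat_transpose_mulVec {n : ℕ} {src tgt : Fin n → Fin (n + 1)}
    (hne : ∀ k, src k ≠ tgt k) (Rb : Fin n → M3) (y : Fin (n + 1) × Fin 3 → ℝ)
    (k : Fin n) (j : Fin 3) :
    ((Lmat src tgt Rb)ᵀ *ᵥ y) (k, j) =
      y (tgt k, j) - ((Rb k)ᵀ *ᵥ fun l => y (src k, l)) j := by
  have h : ∀ i, ∑ l, Lblk src tgt Rb i k l j * y (i, l) =
      (if i = tgt k then y (i, j) else 0) +
        if i = src k then -((Rb k)ᵀ *ᵥ fun l => y (i, l)) j else 0 := by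
    intro i
    by_cases h1 : i = tgt k
    · have h2 : i ≠ src k := fun h => hne k (h.symm.trans h1)
      rw [if_neg h2]
      simp [Lblk, h1, Matrix.one_apply]
    · by_cases h2 : i = src k
      · rw [if_neg h1]
        simp [Lblk, h2, hne k, Matrix.mulVec, dotProduct]
      · simp [Lblk, h1, h2]
  simp only [Matrix.mulVec, dotProduct, Matrix.transpose_apply, Lmat, Fintype.sum_prod_type] at h ⊢
  simp only [h, Finset.sum_add_distrib, Finset.sum_ite_eq', Finset.mem_univ, if_true, sub_eq_add_neg]

theorem transposeMap_injective {n : ℕ} {G : SimpleGraph (Fin (n + 1))} (hG : G.Connected)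
    {src tgt : Fin n → Fin (n + 1)} (hadj : ∀ k, G.Adj (src k) (tgt k))
    (hsurj : ∀ e ∈ G.edgeSet, ∃ k, e = s(src k, tgt k))
    {Rb : Fin n → M3} (hRb : ∀ k, SO3 (Rb k)) :
    Function.Injective (transposeMap src tgt Rb) := by
  rw [injective_iff_map_eq_zero]
  intro y hy
  have h1 : (Lmat src tgt Rb)ᵀ *ᵥ y = 0 := congrArg Prod.fst hy
  have h0 : (fun j => y (0, j)) = 0 := congrArg Prod.snd hy
  have hedge : ∀ k, (fun j => y (tgt k, j)) = (Rb k)ᵀ *ᵥ fun l => y (src k, l) := by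
    intro k
    ext j
    have := congrFun h1 (k, j)
    rw [Lmat_transpose_mulVec (fun k => (hadj k).ne)] at this
    exact sub_eq_zero.1 this
  have hstep : ∀ u v, G.Adj u v → (fun j => y (u, j)) = 0 → (fun j => y (v, j)) = 0 := by
    intro u v huv hu
    obtain ⟨k, hk⟩ := hsurj s(u, v) huv
    rcases Sym2.eq_iff.1 hk with ⟨rfl, rfl⟩ | ⟨rfl, rfl⟩
    · rw [hedge, hu, Matrix.mulVec_zero]
    · have h2 := congrArg (Rb k *ᵥ ·) (hedge k)
      simp only [hu, Matrix.mulVec_mulVec, (hRb k).2.1, Matrix.one_mulVec, Matrix.mulVec_zero] at h2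
      exact h2.symm
  have hwalk : ∀ u v (p : G.Walk u v), (fun j => y (u, j)) = 0 → (fun j => y (v, j)) = 0 := by
    intro u v p
    induction p with
    | nil => exact id
    | cons h _ ih => exact fun hu => ih (hstep _ _ h hu)
  ext ⟨v, j⟩
  obtain ⟨p⟩ := hG.preconnected 0 v
  exact congrFun (hwalk 0 v p h0) j

theorem eq_zero_of_root_add_Lmat_mulVec_eq_zero {n : ℕ} {G : SimpleGraph (Fin (n + 1))}
    (hG : G.Connected) {src tgt : Fin n → Fin (n + 1)} (hadj : ∀ k, G.Adj (src k) (tgt k))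
    (hsurj : ∀ e ∈ G.edgeSet, ∃ k, e = s(src k, tgt k))
    {Rb : Fin n → M3} (hRb : ∀ k, SO3 (Rb k)) {p : Fin 3 → ℝ} {w : Fin n × Fin 3 → ℝ}
    (h : (fun q : Fin (n + 1) × Fin 3 => if q.1 = 0 then p q.2 else 0)
      + Lmat src tgt Rb *ᵥ w = 0) : p = 0 ∧ w = 0 := by
  have hfin : Module.finrank ℝ (Fin (n + 1) × Fin 3 → ℝ) =
      Module.finrank ℝ ((Fin n × Fin 3 → ℝ) × (Fin 3 → ℝ)) := by
    simp
    ring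
  have hsur := (LinearMap.injective_iff_surjective_of_finrank_eq_finrank hfin).1
    (transposeMap_injective hG hadj hsurj hRb)
  obtain ⟨y, hy⟩ := hsur (w, p)
  have hw : (Lmat src tgt Rb)ᵀ *ᵥ y = w := congrArg Prod.fst hy
  have hp : (fun j => y (0, j)) = p := congrArg Prod.snd hy
  have h1 := congrArg (y ⬝ᵥ ·) h
  have h2 : y ⬝ᵥ (fun q : Fin (n + 1) × Fin 3 => if q.1 = 0 then p q.2 else 0) = p ⬝ᵥ p := by
    nth_rewrite 2 [← hp]
    simp only [dotProduct, Fintype.sum_prod_type, mul_ite, mul_zero]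
    rw [Finset.sum_eq_single 0 (by intro b _ hb; simp [hb]) (by simp)]
    simp
  simp only [dotProduct_add, dotProduct_zero, h2, Matrix.dotProduct_mulVec] at h1
  rw [← Matrix.mulVec_transpose, hw] at h1
  have hp0 : 0 ≤ p ⬝ᵥ p := dotProduct_self_star_nonneg p
  have hw0 : 0 ≤ w ⬝ᵥ w := dotProduct_self_star_nonneg w
  exact ⟨dotProduct_self_eq_zero.1 (by linarith), dotProduct_self_eq_zero.1 (by linarith)⟩

/-- With symmetric positive definite `A₀, A₁, …, A_{N-1}`, each having
three distinct eigenvalues, `k_{R̄₀} Ψ₀ + k_{R̄} L Ψ̄ = 0` holds if and only if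
`R̄₀ ∈ {I₃} ∪ {ℛ(π,v) : v unit eigenvector of A₀}` and, for each `k`,
`R̄_k ∈ {I₃} ∪ {ℛ(π,v) : v unit eigenvector of A_k}`. -/
theorem stmt9 {n : ℕ} (hn : 1 ≤ n)
    (G : SimpleGraph (Fin (n + 1))) (hT : G.IsTree)
    (src tgt : Fin n → Fin (n + 1))
    (hadj : ∀ k, G.Adj (src k) (tgt k))
    (hinj : Function.Injective fun k => s(src k, tgt k))
    (hsurj : ∀ e ∈ G.edgeSet, ∃ k, e = s(src k, tgt k))
    (Rb : Fin n → M3) (hRb : ∀ k, SO3 (Rb k))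
    (Rb0 : M3) (hRb0 : SO3 Rb0)
    (A0 : M3) (A : Fin n → M3)
    (hA0pd : A0.PosDef) (hApd : ∀ k, (A k).PosDef)
    (hA0dist : ∃ l : Fin 3 → ℝ, Function.Injective l ∧ spectrum ℝ A0 = Set.range l)
    (hAdist : ∀ k, ∃ l : Fin 3 → ℝ, Function.Injective l ∧ spectrum ℝ (A k) = Set.range l)
    (k0 kR : ℝ) (hk0 : 0 < k0) (hkR : 0 < kR) :
    ((k0 • fun p : Fin (n + 1) × Fin 3 => if p.1 = 0 then psi (A0 * Rb0) p.2 else 0)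
        + kR • (Lmat src tgt Rb *ᵥ fun q : Fin n × Fin 3 => psi (A q.1 * Rb q.1) q.2)
        = 0)
    ↔ ((Rb0 = 1 ∨ ∃ v : Fin 3 → ℝ, v ⬝ᵥ v = 1 ∧ (∃ μ : ℝ, A0 *ᵥ v = μ • v)
          ∧ Rb0 = rotAA Real.pi v)
      ∧ ∀ k, (Rb k = 1 ∨ ∃ v : Fin 3 → ℝ, v ⬝ᵥ v = 1 ∧ (∃ μ : ℝ, A k *ᵥ v = μ • v)
          ∧ Rb k = rotAA Real.pi v)) := by
  rw [← psi_mul_eq_zero_iff hA0pd hRb0]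
  simp only [← psi_mul_eq_zero_iff (hApd _) (hRb _)]
  constructor
  · intro h
    rw [← Matrix.mulVec_smul] at h
    obtain ⟨hp, hw⟩ := eq_zero_of_root_add_Lmat_mulVec_eq_zero hT.connected hadj hsurj hRb
      (p := k0 • psi (A0 * Rb0)) (by
        rw [← h]
        congr 1
        ext q
        simp)
    refine ⟨(smul_eq_zero.1 hp).resolve_left hk0.ne', fun k => ?_⟩
    ext j
    exact congrFun ((smul_eq_zero.1 hw).resolve_left hkR.ne') (k, j)
  · rintro ⟨h0, hk⟩
    ext q
    simp [h0, hk, Matrix.mulVec, dotProduct]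
end
end

section
/- For every symmetric matrix A ∈ ℝ^{3×3}, every θ ∈ ℝ, and every unit vector u ∈ ℝ³, one has tr(A (I₃ − ℛ(θ,u))) = 2 (1 − cos(θ)) uᵀ E(A) u. -/
open Matrix BigOperators

noncomputable section

/-- For symmetric `A`, any `θ ∈ ℝ` and unit `u ∈ ℝ³`:
`tr(A(I₃ - ℛ(θ,u))) = 2(1 - cos θ) uᵀ E(A) u`. -/
theorem stmt10 (A : M3) (hA : Aᵀ = A) (θ : ℝ) (u : Fin 3 → ℝ) (hu : u ⬝ᵥ u = 1) :
    (A * (1 - rotAA θ u)).trace = 2 * (1 - Real.cos θ) * (u ⬝ᵥ (Emat A *ᵥ u)) := by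
  have h01 : A 1 0 = A 0 1 := congrFun (congrFun hA 0) 1
  have h02 : A 2 0 = A 0 2 := congrFun (congrFun hA 0) 2
  have h12 : A 2 1 = A 1 2 := congrFun (congrFun hA 1) 2
  simp [rotAA, Emat, skew, Matrix.trace, Matrix.mul_apply, Matrix.mulVec, dotProduct,
    Fin.sum_univ_three, Matrix.one_apply, h01, h02, h12]
  ring
end
end

section
/- Let A ∈ ℝ^{3×3} be symmetric positive definite with three distinct eigenvalues, and let v ∈ ℝ³ be a unit eigenvector of A. Then the matrix A ℛ(π, v) is symmetric, and E(A ℛ(π, v)) is symmetric and nonsingular. -/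
open Matrix BigOperators

noncomputable section

/-- If `A v = lam v` with `v` a unit vector, then `A ℛ(π, v) = 2 lam v vᵀ - A`. -/
theorem mul_rotAA_pi (A : M3) (v : Fin 3 → ℝ) (hv : v ⬝ᵥ v = 1) (lam : ℝ)
    (hev : A *ᵥ v = lam • v) :
    A * rotAA Real.pi v = (2 * lam) • vecMulVec v v - A := by
  rw [rotAA_pi v hv, Matrix.mul_sub, Matrix.mul_one, Matrix.mul_smul, mul_vecMulVec, hev,
    smul_vecMulVec, smul_smul]

theorem dotProduct_mulVec_of_transpose_eq {A : M3} (hA : Aᵀ = A) {b : Fin 3 → ℝ} {e : ℝ}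
    (hb : A *ᵥ b = e • b) (w : Fin 3 → ℝ) : b ⬝ᵥ A *ᵥ w = e * (b ⬝ᵥ w) := by
  rw [dotProduct_mulVec, ← mulVec_transpose, hA, hb, smul_dotProduct, smul_eq_mul]

/-- A positive definite matrix with three distinct eigenvalues has a complete family of
eigenvectors with distinct positive eigenvalues summing to the trace. -/
theorem exists_eigenvectors (A : M3) (hApd : A.PosDef)
    (hdist : ∃ l : Fin 3 → ℝ, Function.Injective l ∧ spectrum ℝ A = Set.range l) :
    ∃ (e : Fin 3 → ℝ) (b : Fin 3 → Fin 3 → ℝ), Function.Injective e ∧ (∀ i, 0 < e i) ∧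
      A.trace = ∑ i, e i ∧ (∀ i, A *ᵥ b i = e i • b i) ∧
      ∀ w : Fin 3 → ℝ, (∀ i, b i ⬝ᵥ w = 0) → w = 0 := by
  have hH := hApd.isHermitian
  obtain ⟨l, hl, hs⟩ := hdist
  refine ⟨hH.eigenvalues, fun i => hH.eigenvectorBasis i, ?_, hApd.eigenvalues_pos, ?_,
    hH.mulVec_eigenvectorBasis, ?_⟩
  · rw [hH.spectrum_real_eq_range_eigenvalues] at hs
    have hc : (Finset.univ.image hH.eigenvalues) = Finset.univ.image l := by
      apply Finset.coe_injective
      simpa using hs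
    have hcard := Finset.card_image_of_injective Finset.univ hl
    rw [← hc] at hcard
    simpa using Finset.card_image_iff.mp hcard
  · simpa using hH.trace_eq_sum_eigenvalues
  · intro w hw
    have h : WithLp.toLp 2 w = (0 : EuclideanSpace ℝ (Fin 3)) := by
      refine (map_eq_zero_iff hH.eigenvectorBasis.repr
        hH.eigenvectorBasis.repr.injective).mp ?_
      ext i
      rw [OrthonormalBasis.repr_apply_apply, EuclideanSpace.inner_eq_star_dotProduct,
        dotProduct_comm]
      simpa using hw i
    simpa using h

/-- If `A` is symmetric positive definite with three distinct
eigenvalues and `v` is a unit eigenvector of `A`, then `A ℛ(π, v)` is symmetric, and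
`E(A ℛ(π, v))` is symmetric and nonsingular. -/
theorem stmt14 (A : M3) (hApd : A.PosDef)
    (hdist : ∃ l : Fin 3 → ℝ, Function.Injective l ∧ spectrum ℝ A = Set.range l)
    (v : Fin 3 → ℝ) (hv : v ⬝ᵥ v = 1) (lam : ℝ) (hev : A *ᵥ v = lam • v) :
    (A * rotAA Real.pi v)ᵀ = A * rotAA Real.pi v ∧
      (Emat (A * rotAA Real.pi v))ᵀ = Emat (A * rotAA Real.pi v) ∧
      IsUnit (Emat (A * rotAA Real.pi v)).det := by
  have hA : Aᵀ = A := by simpa [IsHermitian] using hApd.isHermitian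
  have hM := mul_rotAA_pi A v hv lam hev
  have hsymm : (A * rotAA Real.pi v)ᵀ = A * rotAA Real.pi v := by
    rw [hM, transpose_sub, transpose_smul, transpose_vecMulVec, hA]
  refine ⟨hsymm, by simp [Emat, hsymm], ?_⟩
  obtain ⟨e, b, he, hpos, htr, hb, hcomplete⟩ := exists_eigenvectors A hApd hdist
  rw [isUnit_iff_ne_zero]
  intro hdet
  obtain ⟨w, hw0, hw⟩ := exists_mulVec_eq_zero_iff.mpr hdet
  have hAw (x : Fin 3 → ℝ) :
      (2 * lam - A.trace) * (x ⬝ᵥ w) - 2 * lam * (x ⬝ᵥ v) * (v ⬝ᵥ w) + x ⬝ᵥ A *ᵥ w = 0 := by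
    have h := congrArg (fun y => x ⬝ᵥ y) hw
    simp only [Emat, hsymm] at h
    rw [hM] at h
    simp only [trace_sub, trace_smul, trace_vecMulVec, hv, sub_mulVec, smul_mulVec, one_mulVec,
      vecMulVec_mulVec, dotProduct_smul, dotProduct_sub, dotProduct_zero, smul_eq_mul,
      op_smul_eq_mul] at h
    linear_combination 2 * h
  obtain ⟨i, hi⟩ : ∃ i, b i ⬝ᵥ v ≠ 0 := by
    by_contra! h
    simp [hcomplete v h] at hv
  have heig (j : Fin 3) : (e j - lam) * (b j ⬝ᵥ v) = 0 := by
    have h := dotProduct_mulVec_of_transpose_eq hA (hb j) v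
    rw [hev, dotProduct_smul, smul_eq_mul] at h
    linear_combination -h
  have hei : e i = lam := by
    have := (mul_eq_zero.mp (heig i)).resolve_right hi
    linarith
  have hbv (j : Fin 3) (hj : j ≠ i) : b j ⬝ᵥ v = 0 :=
    (mul_eq_zero.mp (heig j)).resolve_left (sub_ne_zero.mpr (hei ▸ he.ne hj))
  rw [Fin.sum_univ_three] at htr
  have hvw : v ⬝ᵥ w = 0 := by
    have h := hAw v
    rw [dotProduct_mulVec_of_transpose_eq hA hev, hv] at h
    have h' : (lam - A.trace) * (v ⬝ᵥ w) = 0 := by linear_combination h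
    refine (mul_eq_zero.mp h').resolve_left (ne_of_lt ?_)
    have := hpos 0
    have := hpos 1
    have := hpos 2
    rw [htr, ← hei]
    fin_cases i <;> simp <;> linarith
  have hbw (j : Fin 3) (hj : j ≠ i) : b j ⬝ᵥ w = 0 := by
    have h := hAw (b j)
    rw [dotProduct_mulVec_of_transpose_eq hA (hb j), hvw] at h
    have h' : (2 * lam - A.trace + e j) * (b j ⬝ᵥ w) = 0 := by linear_combination h
    refine (mul_eq_zero.mp h').resolve_left fun h0 => ?_
    have h01 := he.ne (show (0 : Fin 3) ≠ 1 by decide)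
    have h02 := he.ne (show (0 : Fin 3) ≠ 2 by decide)
    have h12 := he.ne (show (1 : Fin 3) ≠ 2 by decide)
    rw [htr, ← hei] at h0
    clear hi hei hbv heig
    fin_cases i <;> fin_cases j <;> simp at hj h0 <;> grind
  have hz : (b i ⬝ᵥ w) • v - (b i ⬝ᵥ v) • w = 0 := by
    refine hcomplete _ fun j => ?_
    by_cases hj : j = i
    · subst hj
      simp [mul_comm]
    · simp [hbv j hj, hbw j hj]
  have hbiw : b i ⬝ᵥ w = 0 := by
    simpa [hv, hvw] using congrArg (fun y => v ⬝ᵥ y) hz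
  refine hw0 (hcomplete w fun j => ?_)
  by_cases hj : j = i
  · exact hj ▸ hbiw
  · exact hbw j hj
end
end

section
/- Let n ≥ 1, let P ∈ ℝ^{n×n} be nonsingular, let G ∈ ℝ^{n×n} be symmetric and nonsingular, let J ∈ ℝ^{n×n} be symmetric positive definite, and let k > 0. Define the 2n×2n real block matrix M := [[0_{n×n}, Pᵀ], [−J⁻¹ P G, −k J⁻¹]]. Then M has no eigenvalue (over ℂ) with zero real part; in particular, M is nonsingular and has no purely imaginary eigenvalues. -/
open Matrix BigOperators

noncomputable section

/-- For Hermitian `A` and imaginary `c`, the number `c * (star x ⬝ᵥ A *ᵥ x)` has zero real part. -/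
lemma Matrix.IsHermitian.re_mul_star_dotProduct_mulVec_self {ι : Type*} [Fintype ι]
    {A : Matrix ι ι ℂ} (hA : A.IsHermitian) {c : ℂ} (hc : c.re = 0) (x : ι → ℂ) :
    (c * (star x ⬝ᵥ A *ᵥ x)).re = 0 := by
  have h : (star x ⬝ᵥ A *ᵥ x).im = 0 := hA.im_star_dotProduct_mulVec_self x
  rw [Complex.mul_re, hc, h]
  ring

/-- A real symmetric matrix is Hermitian as a complex matrix. -/
lemma Matrix.isHermitian_map_ofReal {ι : Type*} {A : Matrix ι ι ℝ} (hA : Aᵀ = A) :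
    (A.map Complex.ofRealHom).IsHermitian := by
  ext i j
  have h : A j i = A i j := congrFun (congrFun hA i) j
  simp [h]

/-- A nonsingular real matrix has trivial kernel over `ℂ`. -/
lemma Matrix.eq_zero_of_map_ofReal_mulVec_eq_zero {ι : Type*} [Fintype ι] [DecidableEq ι]
    {A : Matrix ι ι ℝ} (hA : IsUnit A.det) {x : ι → ℂ}
    (hx : A.map Complex.ofRealHom *ᵥ x = 0) : x = 0 := by
  refine Matrix.eq_zero_of_mulVec_eq_zero ?_ hx
  rw [← RingHom.mapMatrix_apply, ← RingHom.map_det]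
  exact (hA.map Complex.ofRealHom).ne_zero

open scoped ComplexOrder in
/-- A complex vector whose squared Euclidean norm vanishes is zero. -/
lemma Matrix.eq_zero_of_re_star_dotProduct_self_eq_zero {ι : Type*} [Fintype ι]
    {y : ι → ℂ} (hy : (star y ⬝ᵥ y).re = 0) : y = 0 := by
  have hnn : 0 ≤ star y ⬝ᵥ y := dotProduct_star_self_nonneg y
  exact dotProduct_star_self_eq_zero.mp
    (Complex.ext hy (Complex.nonneg_iff.mp hnn).2.symm)

/-- For nonsingular `P`, symmetric nonsingular `G`, symmetric positive
definite `J` and `k > 0`, the block matrix `M = [[0, Pᵀ], [-J⁻¹PG, -kJ⁻¹]]` has no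
eigenvalue (over `ℂ`) with zero real part. -/
theorem stmt15 {n : ℕ} (hn : 1 ≤ n)
    (P G J : Matrix (Fin n) (Fin n) ℝ)
    (hP : IsUnit P.det) (hGsym : Gᵀ = G) (hG : IsUnit G.det)
    (hJ : J.PosDef) (k : ℝ) (hk : 0 < k)
    (μ : ℂ) (hμ : μ.re = 0) :
    ¬ ∃ z : Fin n ⊕ Fin n → ℂ, z ≠ 0 ∧
      (Matrix.fromBlocks (0 : Matrix (Fin n) (Fin n) ℝ) Pᵀ
          (-(J⁻¹ * (P * G))) (-(k • J⁻¹))).map (Complex.ofReal ·) *ᵥ z = μ • z := by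
  rintro ⟨z, hz, h⟩
  obtain ⟨x, y, rfl⟩ : ∃ x y, z = Sum.elim x y := ⟨_, _, (Sum.elim_comp_inl_inr z).symm⟩
  have hJsym : Jᵀ = J := by simpa [Matrix.IsHermitian] using hJ.isHermitian
  have hJdet : IsUnit J.det := hJ.det_pos.ne'.isUnit
  set φ := Complex.ofRealHom
  change (Matrix.map _ φ) *ᵥ _ = _ at h
  rw [Matrix.fromBlocks_map, Matrix.fromBlocks_mulVec, Sum.elim_comp_inl,
    Sum.elim_comp_inr] at h
  have h₁ : Pᵀ.map φ *ᵥ y = μ • x := by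
    ext i
    simpa using congrFun h (Sum.inl i)
  have h₂ : (-(J⁻¹ * (P * G))).map φ *ᵥ x + (-(k • J⁻¹)).map φ *ᵥ y = μ • y := by
    ext i
    simpa using congrFun h (Sum.inr i)
  have h₃ : -((P * G).map φ *ᵥ x) - (k : ℂ) • y = μ • (J.map φ *ᵥ y) := by
    have e₁ : J * -(J⁻¹ * (P * G)) = -(P * G) := by
      rw [Matrix.mul_neg, Matrix.mul_nonsing_inv_cancel_left _ _ hJdet]
    have e₂ : J * -(k • J⁻¹) = -(k • (1 : Matrix (Fin n) (Fin n) ℝ)) := by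
      rw [Matrix.mul_neg, Matrix.mul_smul, Matrix.mul_nonsing_inv _ hJdet]
    have e₃ : (-(P * G)).map φ = -(P * G).map φ := map_neg φ.mapMatrix _
    have e₄ : (-(k • (1 : Matrix (Fin n) (Fin n) ℝ))).map φ = -((k : ℂ) • 1) := by
      ext i j
      by_cases hij : i = j <;> simp [φ, hij]
    have := congrArg (J.map φ *ᵥ ·) h₂
    simpa only [Matrix.mulVec_add, Matrix.mulVec_mulVec, ← Matrix.map_mul, e₁, e₂, e₃, e₄,
      Matrix.mulVec_smul, Matrix.neg_mulVec, Matrix.smul_mulVec, Matrix.one_mulVec,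
      ← sub_eq_add_neg] using this
  have hPy : star y ᵥ* P.map φ = star μ • star x := by
    rw [← star_smul, ← h₁, Matrix.star_mulVec]
    congr 1
    ext i j
    simp [φ]
  have key : star μ * (star x ⬝ᵥ G.map φ *ᵥ x) + k * (star y ⬝ᵥ y)
      + μ * (star y ⬝ᵥ J.map φ *ᵥ y) = 0 := by
    have := congrArg (star y ⬝ᵥ ·) h₃
    simp only [Matrix.map_mul, ← Matrix.mulVec_mulVec, dotProduct_sub, dotProduct_neg,
      dotProduct_smul, smul_eq_mul] at this
    rw [Matrix.dotProduct_mulVec, hPy, smul_dotProduct, smul_eq_mul] at this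
    linear_combination -this
  have hy : y = 0 := by
    have hre := congrArg Complex.re key
    have hμ' : (star μ).re = 0 := by simpa using hμ
    rw [Complex.add_re, Complex.add_re,
      (isHermitian_map_ofReal hGsym).re_mul_star_dotProduct_mulVec_self hμ',
      (isHermitian_map_ofReal hJsym).re_mul_star_dotProduct_mulVec_self hμ,
      Complex.re_ofReal_mul, Complex.zero_re, zero_add, add_zero] at hre
    exact eq_zero_of_re_star_dotProduct_self_eq_zero
      ((mul_eq_zero.mp hre).resolve_left hk.ne')
  have hx : x = 0 := by
    refine eq_zero_of_map_ofReal_mulVec_eq_zero (A := P * G) ?_ ?_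
    · rw [Matrix.det_mul]
      exact hP.mul hG
    · simpa [hy] using h₃
  apply hz
  ext (i | i) <;> simp [hx, hy]
end
end
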